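/- For every m ∈ G(I^k) and every s ∈ set(m), the decomposition function satisfies: g(x_s·m) = x_s·m/x_{min(m)} if x_s·m/x_{min(m)} ⪰ v^k, and g(x_s·m) = x_s·m/x_{min(m̃)} if x_s·m/x_{min(m)} ≺ v^k, where m̃ is the part of m supported in x_{l+1},…,x_n. -/

import Mathlib

open MvPolynomial Finset

/-- A monomial in `n` variables, recorded by its exponent vector
(index `i : Fin n` corresponds to the variable `x_{i+1}` of the paper). -/
abbrev Mon (n : ℕ) := Fin n →₀ ℕ

/-- The exponent vector of the single variable `x_{j+1}` (`0`-indexed `j`). -/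
noncomputable def sing (n j : ℕ) : Mon n :=
  Finsupp.onFinset Finset.univ (fun i => if (i : ℕ) = j then 1 else 0)
    (fun a _ => Finset.mem_univ a)

/-- Total degree of a monomial. -/
def deg {n : ℕ} (m : Mon n) : ℕ := m.sum fun _ e => e

/-- `m₁ <_lex m₂` for the lexicographic order with `x_1 > x_2 > ⋯ > x_n`. -/
def lexLT {n : ℕ} (m₁ m₂ : Mon n) : Prop :=
  ∃ i : Fin n, (∀ j : Fin n, j < i → m₁ j = m₂ j) ∧ m₁ i < m₂ i

def lexLE {n : ℕ} (m₁ m₂ : Mon n) : Prop := m₁ = m₂ ∨ lexLT m₁ m₂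

/-- `m₁ <_revlex m₂` : the increasing reverse lexicographic order. -/
def revLT {n : ℕ} (m₁ m₂ : Mon n) : Prop :=
  ∃ s : Fin n, (∀ i : Fin n, s < i → m₁ i = m₂ i) ∧ m₂ s < m₁ s

def revLE {n : ℕ} (m₁ m₂ : Mon n) : Prop := m₁ = m₂ ∨ revLT m₁ m₂

/-- `min(m)`: the (0-indexed) smallest index in the support of `m`. -/
noncomputable def minIdx {n : ℕ} (m : Mon n) : ℕ := sInf {j : ℕ | ∃ h : j < n, m ⟨j, h⟩ ≠ 0}

/-- `m̄`: the part of `m` supported in the variables `x_1, …, x_l`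
(0-indexed: indices `< l`). -/
noncomputable def lowPart {n : ℕ} (l : ℕ) (m : Mon n) : Mon n :=
  m.filter fun i => (i : ℕ) < l

/-- `m̃`: the part of `m` supported in the variables `x_{l+1}, …, x_n`
(0-indexed: indices `≥ l`). -/
noncomputable def highPart {n : ℕ} (l : ℕ) (m : Mon n) : Mon n :=
  m.filter fun i => l ≤ (i : ℕ)

/-- The exponent vector of `u = x_1 · x_{l+1}^{a_{l+1}} ⋯ x_n^{a_n}`, where
`a j` (for `l ≤ j < n`, 0-indexed) is the exponent of `x_{j+1}`. -/
noncomputable def uVec (n l : ℕ) (a : ℕ → ℕ) : Mon n :=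
  sing n 0 + ∑ j ∈ Finset.Ico l n, a j • sing n j

/-- The exponent vector of `v = x_l · x_n^{d-1}`. -/
noncomputable def vVec (n l d : ℕ) : Mon n :=
  sing n (l - 1) + (d - 1) • sing n (n - 1)

/-- The lexsegment `L(u,v)`: monomials `w` of degree `d` with `u ≥_lex w ≥_lex v`. -/
def lexSeg (n l d : ℕ) (a : ℕ → ℕ) : Set (Mon n) :=
  { w | deg w = d ∧ lexLE (vVec n l d) w ∧ lexLE w (uVec n l a) }

/-- The lexsegment ideal `I = (L(u,v)) ⊆ K[x_1,…,x_n]`. -/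
noncomputable def lexIdeal (n l d : ℕ) (a : ℕ → ℕ) (K : Type*) [Field K] :
    Ideal (MvPolynomial (Fin n) K) :=
  Ideal.span ((fun w => monomial w (1 : K)) '' lexSeg n l d a)

/-- `G(J)`: the minimal monomial generators of a monomial ideal `J`, i.e.
monomials `m ∈ J` with `m / x_i ∉ J` for every `i ∈ supp m`. -/
def minGens {n : ℕ} (K : Type*) [Field K] (J : Ideal (MvPolynomial (Fin n) K)) :
    Set (Mon n) :=
  { m | monomial m (1 : K) ∈ J ∧
      ∀ i ∈ m.support, monomial (m - Finsupp.single i 1) (1 : K) ∉ J }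

/-- `J_{<revlex m}`: the ideal generated by all `z ∈ G(J)` with `z <_revlex m`. -/
noncomputable def idealBelow {n : ℕ} (K : Type*) [Field K]
    (J : Ideal (MvPolynomial (Fin n) K)) (m : Mon n) : Ideal (MvPolynomial (Fin n) K) :=
  Ideal.span ((fun z => monomial z (1 : K)) '' { z | z ∈ minGens K J ∧ revLT z m })

/-- `set(m) = {j : x_j · m ∈ J_{<revlex m}}` (0-indexed). -/
def setOfGen {n : ℕ} (K : Type*) [Field K] (J : Ideal (MvPolynomial (Fin n) K))
    (m : Mon n) : Set ℕ :=
  { j | j < n ∧ monomial (m + sing n j) (1 : K) ∈ idealBelow K J m }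

/-- The order `≺` on monomials: compare first the degree of the part supported in
`x_1,…,x_l`, then `<_lex`. -/
def precLT {n : ℕ} (l : ℕ) (m₁ m₂ : Mon n) : Prop :=
  deg (lowPart l m₁) < deg (lowPart l m₂) ∨
    (deg (lowPart l m₁) = deg (lowPart l m₂) ∧ lexLT m₁ m₂)

/-- `w = g(z)`: `w` is the `<_revlex`-smallest minimal monomial generator of `J`
dividing the monomial `z` (the value of the decomposition function). -/
def isDecompOf {n : ℕ} (K : Type*) [Field K] (J : Ideal (MvPolynomial (Fin n) K))
    (z w : Mon n) : Prop :=
  w ∈ minGens K J ∧ w ≤ z ∧ ∀ w' ∈ minGens K J, w' ≤ z → revLE w w'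

theorem deg_eq {n : ℕ} (m : Mon n) : deg m = ∑ i, m i := by
  unfold deg
  exact Finsupp.sum_fintype _ _ (fun _ => rfl)

theorem deg_add' {n : ℕ} (a b : Mon n) : deg (a + b) = deg a + deg b := by
  simp [deg_eq, Finset.sum_add_distrib]

theorem deg_single' {n : ℕ} (i : Fin n) : deg (Finsupp.single i 1 : Mon n) = 1 := by
  simp [deg]

noncomputable def lo {n : ℕ} (l : ℕ) (m : Mon n) : ℕ := deg (lowPart l m)

theorem lo_eq {n : ℕ} (l : ℕ) (m : Mon n) :
    lo l m = ∑ i : Fin n, if (i : ℕ) < l then m i else 0 := by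
  simp [lo, deg_eq, lowPart, Finsupp.filter_apply]

theorem lo_add {n : ℕ} (l : ℕ) (a b : Mon n) : lo l (a + b) = lo l a + lo l b := by
  simp [lo, lowPart, Finsupp.filter_add, deg_add']

theorem lo_single {n : ℕ} (l : ℕ) (i : Fin n) :
    lo l (Finsupp.single i 1 : Mon n) = if (i : ℕ) < l then 1 else 0 := by
  rw [lo_eq]
  rw [Finset.sum_eq_single i]
  · simp
  · intro b _ hb
    simp [Finsupp.single_apply, hb.symm]
  · simp

theorem le_lo {n : ℕ} (l : ℕ) (a : Mon n) (i : Fin n) (hi : (i : ℕ) < l) : a i ≤ lo l a := by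
  rw [lo_eq]
  have := Finset.single_le_sum (f := fun i : Fin n => if (i : ℕ) < l then a i else 0)
    (fun _ _ => Nat.zero_le _) (Finset.mem_univ i)
  simpa [hi] using this

theorem lo_pos {n : ℕ} (l : ℕ) (a : Mon n) (h : 1 ≤ lo l a) : ∃ i : Fin n, (i : ℕ) < l ∧ 1 ≤ a i := by
  by_contra! hc
  rw [lo_eq, Finset.sum_eq_zero] at h
  · omega
  · intro i _
    split_ifs with hi
    · have := hc i hi; omega
    · rfl

theorem lo_only {n : ℕ} (l : ℕ) (a : Mon n) (i : Fin n) (hi : (i : ℕ) < l)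
    (h : ∀ j : Fin n, (j : ℕ) < l → j ≠ i → a j = 0) : lo l a = a i := by
  rw [lo_eq, Finset.sum_eq_single i]
  · simp [hi]
  · intro b _ hb
    split_ifs with hb'
    · exact h b hb' hb
    · rfl
  · simp

theorem split {n : ℕ} (a : Mon n) (i : Fin n) (h : 1 ≤ a i) :
    ∃ b, a = b + Finsupp.single i 1 := by
  refine ⟨a - Finsupp.single i 1, ?_⟩
  rw [tsub_add_cancel_of_le]
  simpa using h

theorem sing_eq {n : ℕ} (i : Fin n) : sing n i = Finsupp.single i 1 := by
  ext j
  simp only [sing, Finsupp.onFinset_apply, Finsupp.single_apply, Fin.ext_iff, eq_comm]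

theorem lex_total {n : ℕ} (a b : Mon n) : lexLE a b ∨ lexLT b a := by
  classical
  by_cases h : a = b
  · exact Or.inl (Or.inl h)
  · have hne : (Finset.univ.filter fun i => a i ≠ b i).Nonempty := by
      by_contra hc
      apply h
      ext i
      by_contra hi
      exact hc ⟨i, by simp [hi]⟩
    obtain ⟨i, hi⟩ := Finset.exists_minimal hne
    have h1 : a i ≠ b i := by simpa using hi.1
    have h2 : ∀ j < i, a j = b j := by
      intro j hj
      by_contra hc
      exact absurd (hi.2 (show j ∈ _ by simp [hc]) hj.le) (not_le.2 hj)
    rcases lt_or_gt_of_ne h1 with h3 | h3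
    · exact Or.inl (Or.inr ⟨i, h2, h3⟩)
    · exact Or.inr ⟨i, fun j hj => (h2 j hj).symm, h3⟩

theorem lexLE_of_lt_of_le {n : ℕ} {a b c : Mon n} (h : lexLT a b) (h' : lexLE b c) : lexLE a c := by
  rcases h' with rfl | ⟨j, hj, hj'⟩
  · exact Or.inr h
  · obtain ⟨i, hi, hi'⟩ := h
    right
    rcases lt_trichotomy i j with hij | hij | hij
    · exact ⟨i, fun t ht => (hi t ht).trans (hj t (ht.trans hij)), by rw [← hj i hij]; exact hi'⟩
    · subst hij
      exact ⟨i, fun t ht => (hi t ht).trans (hj t ht), hi'.trans hj'⟩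
    · exact ⟨j, fun t ht => (hi t (ht.trans hij)).trans (hj t ht), by rw [hi j hij]; exact hj'⟩

theorem v_apply {n l d : ℕ} (i : Fin n) : vVec n l d i =
    (if (i : ℕ) = l - 1 then 1 else 0) + (d - 1) * (if (i : ℕ) = n - 1 then 1 else 0) := by
  simp [vVec, sing]

theorem u_apply {n l : ℕ} (a : ℕ → ℕ) (i : Fin n) (hi : (i : ℕ) < l) : uVec n l a i =
    (if (i : ℕ) = 0 then 1 else 0) := by
  simp only [uVec, sing, Finsupp.add_apply, Finsupp.onFinset_apply, Finsupp.finsetSum_apply,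
    Finsupp.smul_apply]
  rw [Finset.sum_eq_zero]
  · simp
  · intro j hj
    have := Finset.mem_Ico.1 hj
    have : (i : ℕ) ≠ j := by omega
    simp [this]

theorem deg_v {n l d : ℕ} (hd : 2 ≤ d) (hl2 : 2 ≤ l) (hln : l ≤ n - 1) : deg (vVec n l d) = d := by
  have h1 := sing_eq (⟨l - 1, by omega⟩ : Fin n)
  have h2 := sing_eq (⟨n - 1, by omega⟩ : Fin n)
  have h3 : ∀ (t : ℕ) (x : Mon n), deg (t • x) = t * deg x := by
    intro t x
    simp [deg_eq, Finset.mul_sum]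
  simp only at h1 h2
  rw [vVec, deg_add', h3, h1, h2, deg_single', deg_single']
  omega

theorem deg_smul' {n : ℕ} (t : ℕ) (x : Mon n) : deg (t • x) = t * deg x := by
  simp [deg_eq, Finset.mul_sum]

theorem not_lex_v {n l d k : ℕ} (hd : 2 ≤ d) (hl2 : 2 ≤ l) (hln : l ≤ n - 1) (X : Mon n)
    (hX : deg X = k * d) (hlo : k ≤ lo l X) : ¬ lexLT X (k • vVec n l d) := by
  rintro ⟨i, hi, hi'⟩
  have hv : ∀ j : Fin n, (k • vVec n l d) j = k * ((if (j : ℕ) = l - 1 then 1 else 0) +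
      (d - 1) * (if (j : ℕ) = n - 1 then 1 else 0)) := by
    intro j; rw [← v_apply]; simp
  by_cases h1 : (i : ℕ) = l - 1
  · have := lo_only l X i (by omega) (by
      intro j hj hji
      have hlt : j < i := by
        have : (j : ℕ) ≠ i := fun h => hji (Fin.ext h)
        rw [Fin.lt_def]; omega
      have hlt' := Fin.lt_def.1 hlt
      rw [hi j hlt, hv, if_neg (by omega), if_neg (by omega)]; simp)
    rw [hv, if_pos h1, if_neg (by omega)] at hi'
    simp at hi'
    omega
  · by_cases h2 : (i : ℕ) = n - 1
    · have hlt : deg X < deg (k • vVec n l d) := by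
        rw [deg_eq, deg_eq]
        apply Finset.sum_lt_sum
        · intro j _
          rcases lt_or_eq_of_le (show j ≤ i by rw [Fin.le_def]; omega) with h | h
          · exact (hi j h).le
          · rw [h]; exact hi'.le
        · exact ⟨i, Finset.mem_univ _, hi'⟩
      rw [deg_smul', deg_v hd hl2 hln] at hlt
      omega
    · rw [hv, if_neg h1, if_neg h2] at hi'
      simp at hi'

section seg
variable {n l d : ℕ} {a : ℕ → ℕ}

theorem v_le (hd : 2 ≤ d) (hl2 : 2 ≤ l) (hln : l ≤ n - 1) (X : Mon n)
    (hX : deg X = d) (hlo : 1 ≤ lo l X) : lexLE (vVec n l d) X := by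
  rcases lex_total (vVec n l d) X with h | h
  · exact h
  · exact absurd (by simpa using h) (not_lex_v (k := 1) hd hl2 hln X (by simpa using hX) hlo)

theorem seg_lo (hl2 : 2 ≤ l) (hln : l ≤ n - 1) (w : Mon n) (hw : w ∈ lexSeg n l d a) :
    1 ≤ lo l w := by
  obtain ⟨_, hv, _⟩ := hw
  by_contra hc
  have hz : ∀ j : Fin n, (j : ℕ) < l → w j = 0 := fun j hj => by
    have := le_lo l w j hj; omega
  let q : Fin n := ⟨l - 1, by omega⟩
  have hq : 1 ≤ vVec n l d q := by rw [v_apply]; simp [q]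
  have hwq := hz q (by simp only [q]; omega)
  rcases hv with h | ⟨i, hi, hi'⟩
  · rw [h] at hq; omega
  · by_cases h : q < i
    · rw [hi q h] at hq; omega
    · have : (i : ℕ) ≤ l - 1 := by
        have := Fin.le_def.1 (not_lt.1 h); simpa [q] using this
      have := hz i (by omega)
      omega

theorem seg_zero (hl2 : 2 ≤ l) (hln : l ≤ n - 1) (w : Mon n) (hw : w ∈ lexSeg n l d a)
    (o : Fin n) (ho : (o : ℕ) = 0) : w o = 0 ∨ (w o = 1 ∧ lo l w = 1) := by
  obtain ⟨_, _, hu⟩ := hw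
  have huo : uVec n l a o = 1 := by rw [u_apply _ _ (by omega)]; simp [ho]
  have hu0 : ∀ j : Fin n, (j : ℕ) < l → j ≠ o → uVec n l a j = 0 := by
    intro j hj hjo
    rw [u_apply _ _ hj, if_neg]
    intro h; apply hjo; ext; omega
  rcases hu with rfl | ⟨i, hi, hi'⟩
  · right
    exact ⟨huo, by rw [lo_only l _ o (by omega) hu0, huo]⟩
  · by_cases h : i = o
    · left; subst h; omega
    · have hoi : o < i := by
        have : (i : ℕ) ≠ o := fun h' => h (Fin.ext h')
        rw [Fin.lt_def]; omega
      have hil : l ≤ (i : ℕ) := by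
        by_contra hc
        have := hu0 i (by omega) h
        omega
      right
      have h1 : w o = 1 := by rw [hi o hoi, huo]
      refine ⟨h1, ?_⟩
      rw [lo_only l w o (by omega), h1]
      intro j hj hjo
      rw [hi j (by rw [Fin.lt_def]; omega)]
      exact hu0 j hj hjo

theorem seg_of_zero (hd : 2 ≤ d) (hl2 : 2 ≤ l) (hln : l ≤ n - 1) (w : Mon n) (h1 : deg w = d)
    (h2 : 1 ≤ lo l w) (o : Fin n) (ho : (o : ℕ) = 0) (h3 : w o = 0) : w ∈ lexSeg n l d a := by
  refine ⟨h1, v_le hd hl2 hln w h1 h2, Or.inr ⟨o, ?_, ?_⟩⟩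
  · intro j hj
    have := Fin.lt_def.1 hj
    omega
  · rw [u_apply _ _ (by omega), h3]; simp [ho]

theorem seg_of_lt (hd : 2 ≤ d) (hl2 : 2 ≤ l) (hln : l ≤ n - 1) (w w' : Mon n) (h1 : deg w' = d)
    (h2 : 1 ≤ lo l w') (h3 : lexLT w' w) (h4 : w ∈ lexSeg n l d a) : w' ∈ lexSeg n l d a :=
  ⟨h1, v_le hd hl2 hln w' h1 h2, lexLE_of_lt_of_le h3 h4.2.2⟩

/-- sums of `k` elements of the lexsegment -/
def PP (n l d : ℕ) (a : ℕ → ℕ) (k : ℕ) : Set (Mon n) :=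
  {m | ∃ M : Multiset (Mon n), M.card = k ∧ (∀ w ∈ M, w ∈ lexSeg n l d a) ∧ M.sum = m}

theorem deg_PP (k : ℕ) (m : Mon n) (hm : m ∈ PP n l d a k) : deg m = k * d := by
  obtain ⟨M, rfl, hM, rfl⟩ := hm
  induction M using Multiset.induction with
  | empty => simp [deg]
  | cons w M ih =>
    rw [Multiset.sum_cons, deg_add', ih (fun w hw => hM w (by simp [hw])),
      (hM w (by simp)).1, Multiset.card_cons]
    ring

theorem lo_PP (hl2 : 2 ≤ l) (hln : l ≤ n - 1) (M : Multiset (Mon n))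
    (hM : ∀ w ∈ M, w ∈ lexSeg n l d a) : M.card ≤ lo l M.sum := by
  induction M using Multiset.induction with
  | empty => simp
  | cons w M ih =>
    rw [Multiset.sum_cons, lo_add, Multiset.card_cons]
    have := ih (fun w hw => hM w (by simp [hw]))
    have := seg_lo hl2 hln w (hM w (by simp))
    omega

theorem exists_big (M : Multiset (Mon n)) (h : M.card < lo l M.sum) : ∃ w ∈ M, 2 ≤ lo l w := by
  induction M using Multiset.induction with
  | empty => simp [lo_eq] at h
  | cons w M ih =>
    rw [Multiset.sum_cons, lo_add, Multiset.card_cons] at h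
    by_cases hw : 2 ≤ lo l w
    · exact ⟨w, by simp, hw⟩
    · obtain ⟨z, hz, hz'⟩ := ih (by omega)
      exact ⟨z, by simp [hz], hz'⟩

theorem exists_coord (M : Multiset (Mon n)) (p : Fin n) (h : 1 ≤ M.sum p) : ∃ w ∈ M, 1 ≤ w p := by
  induction M using Multiset.induction with
  | empty => simp at h
  | cons w M ih =>
    rw [Multiset.sum_cons, Finsupp.add_apply] at h
    by_cases hw : 1 ≤ w p
    · exact ⟨w, by simp, hw⟩
    · obtain ⟨z, hz, hz'⟩ := ih (by omega)
      exact ⟨z, by simp [hz], hz'⟩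

theorem pow_eq (K : Type*) [Field K] (k : ℕ) : (lexIdeal n l d a K) ^ k =
    Ideal.span ((fun w => monomial w (1 : K)) '' PP n l d a k) := by
  induction k with
  | zero =>
    symm
    rw [pow_zero, Ideal.one_eq_top, Ideal.eq_top_iff_one]
    apply Ideal.subset_span
    exact ⟨0, ⟨0, by simp⟩, rfl⟩
  | succ k ih =>
    rw [pow_succ, ih, lexIdeal, Ideal.span_mul_span']
    congr 1
    ext x
    simp only [Set.mem_mul, Set.mem_image]
    constructor
    · rintro ⟨_, ⟨m, ⟨M, h1, h2, rfl⟩, rfl⟩, _, ⟨w, hw, rfl⟩, rfl⟩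
      refine ⟨w + M.sum, ⟨w ::ₘ M, by simp [h1], ?_, by simp⟩, ?_⟩
      · intro z hz
        rcases Multiset.mem_cons.1 hz with rfl | hz
        · exact hw
        · exact h2 z hz
      · rw [MvPolynomial.monomial_mul, add_comm]; simp
    · rintro ⟨_, ⟨M, h1, h2, rfl⟩, rfl⟩
      obtain ⟨w, hw⟩ : ∃ w, w ∈ M := Multiset.card_pos_iff_exists_mem.1 (by omega)
      obtain ⟨N, rfl⟩ := Multiset.exists_cons_of_mem hw
      refine ⟨_, ⟨N.sum, ⟨N, by simpa using h1, fun z hz => h2 z (by simp [hz]), rfl⟩, rfl⟩,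
        _, ⟨w, h2 w hw, rfl⟩, ?_⟩
      rw [MvPolynomial.monomial_mul, add_comm]; simp

theorem mono_mem (K : Type*) [Field K] (S : Set (Mon n)) (m : Mon n) :
    monomial m (1 : K) ∈ Ideal.span ((fun w => monomial w (1 : K)) '' S) ↔ ∃ z ∈ S, z ≤ m := by
  classical
  rw [MvPolynomial.mem_ideal_span_monomial_image]
  simp [MvPolynomial.support_monomial]

theorem minGens_eq (K : Type*) [Field K] (k : ℕ) :
    minGens K ((lexIdeal n l d a K) ^ k) = PP n l d a k := by
  ext m
  simp only [minGens, Set.mem_ofPred_eq, pow_eq, mono_mem]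
  constructor
  · rintro ⟨⟨z, hz, hzm⟩, h⟩
    by_cases hzm' : z = m
    · rwa [← hzm']
    · exfalso
      obtain ⟨i, hi⟩ : ∃ i, z i ≠ m i := by
        by_contra! hc
        exact hzm' (Finsupp.ext hc)
      have hi2 : z i < m i := lt_of_le_of_ne (hzm i) hi
      refine h i (by simp; omega) ⟨z, hz, ?_⟩
      intro j
      have := hzm j
      rw [Finsupp.tsub_apply, Finsupp.single_apply]
      split_ifs with hij
      · subst hij; omega
      · simpa using this
  · intro hm
    refine ⟨⟨m, hm, le_rfl⟩, ?_⟩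
    rintro i hi ⟨z, hz, hzm⟩
    obtain ⟨b, hb⟩ := split m i (by simp at hi; omega)
    rw [hb, add_tsub_cancel_right] at hzm
    have h1 := deg_PP k z hz
    have h2 := deg_PP k m hm
    rw [hb, deg_add', deg_single'] at h2
    have h3 : deg z ≤ deg b := by
      rw [deg_eq, deg_eq]
      exact Finset.sum_le_sum fun i _ => hzm i
    omega

theorem exists_single (m : Mon n) (h : deg m = 1) : ∃ j, m = Finsupp.single j 1 := by
  obtain ⟨j, hj⟩ : ∃ j, m j ≠ 0 := by
    by_contra! hc
    rw [deg_eq, Finset.sum_eq_zero (fun i _ => hc i)] at h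
    omega
  obtain ⟨b, hb⟩ := split m j (by omega)
  refine ⟨j, ?_⟩
  rw [hb, deg_add', deg_single'] at h
  have : b = 0 := by
    ext i
    have h0 : deg b = 0 := by omega
    rw [deg_eq, Finset.sum_eq_zero_iff] at h0
    exact h0 i (Finset.mem_univ i)
  rw [hb, this, zero_add]

theorem div_struct (k : ℕ) (m z : Mon n) (s : Fin n) (hm : m ∈ PP n l d a k)
    (hz : z ∈ PP n l d a k) (h : z ≤ m + Finsupp.single s 1) :
    ∃ j, z + Finsupp.single j 1 = m + Finsupp.single s 1 := by
  obtain ⟨c, hc⟩ := exists_add_of_le h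
  have h1 := congrArg deg hc
  rw [deg_add', deg_add', deg_single', deg_PP k m hm, deg_PP k z hz] at h1
  obtain ⟨j, rfl⟩ := exists_single c (by omega)
  exact ⟨j, hc.symm⟩

theorem set_struct (K : Type*) [Field K] (k : ℕ) (m : Mon n) (s : ℕ) (hm : m ∈ PP n l d a k)
    (hs : s ∈ setOfGen K ((lexIdeal n l d a K) ^ k) m) :
    ∃ h : s < n, ∃ j : Fin n, ∃ z ∈ PP n l d a k, (j : ℕ) < s ∧ 1 ≤ m j ∧
      z + Finsupp.single j 1 = m + Finsupp.single ⟨s, h⟩ 1 := by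
  obtain ⟨h, hs⟩ := hs
  refine ⟨h, ?_⟩
  have hse := sing_eq (⟨s, h⟩ : Fin n)
  simp only at hse
  rw [idealBelow, mono_mem, minGens_eq, hse] at hs
  obtain ⟨z, ⟨hz, r, hr, hr'⟩, hzm⟩ := hs
  obtain ⟨j, hj⟩ := div_struct k m z _ hm hz hzm
  have hE : ∀ i, z i + (if j = i then 1 else 0) = m i + (if (⟨s, h⟩ : Fin n) = i then 1 else 0) := by
    intro i
    have := DFunLike.congr_fun hj i
    simpa [Finsupp.single_apply] using this
  have hrs : (⟨s, h⟩ : Fin n) = r := by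
    by_contra hc
    have := hE r
    rw [if_neg hc] at this
    omega
  have hjr : j ≠ r := by
    intro hc
    have := hE r
    rw [if_pos hc, if_pos hrs] at this
    omega
  have hEj := hE j
  rw [if_pos rfl, if_neg (fun hc => hjr (by rw [← hrs, ← hc]))] at hEj
  refine ⟨j, z, hz, ?_, by omega, hj⟩
  by_contra hc
  have : r < j := by
    have h1 : (r : ℕ) = s := by rw [← hrs]
    have h2 : (j : ℕ) ≠ r := fun h' => hjr (Fin.ext h')
    rw [Fin.lt_def]; omega
  have := hr j this
  omega

theorem minIdx_spec (m : Mon n) (j : Fin n) (hj : 1 ≤ m j) :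
    ∃ p : Fin n, minIdx m = p ∧ 1 ≤ m p ∧ ∀ i, 1 ≤ m i → p ≤ i := by
  have hne : {j : ℕ | ∃ h : j < n, m ⟨j, h⟩ ≠ 0}.Nonempty := ⟨j, j.2, by simpa using by omega⟩
  obtain ⟨h, h'⟩ := Nat.sInf_mem hne
  refine ⟨⟨minIdx m, h⟩, rfl, Nat.one_le_iff_ne_zero.2 h', ?_⟩
  intro i hi
  exact Nat.sInf_le (show (i : ℕ) ∈ _ from ⟨i.2, by simpa using by omega⟩)

theorem decomp_of (K : Type*) [Field K] (k : ℕ) (m W : Mon n) (s p : Fin n)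
    (hm : m ∈ PP n l d a k) (hW : W ∈ PP n l d a k)
    (hWp : W + Finsupp.single p 1 = m + Finsupp.single s 1)
    (h : ∀ w ∈ PP n l d a k, ∀ j, w + Finsupp.single j 1 = m + Finsupp.single s 1 → p ≤ j) :
    isDecompOf K ((lexIdeal n l d a K) ^ k) (m + Finsupp.single s 1) W := by
  rw [isDecompOf, minGens_eq]
  refine ⟨hW, ?_, ?_⟩
  · rw [← hWp]; exact le_self_add
  · intro w hw hwm
    obtain ⟨j, hj⟩ := div_struct k m w s hm hw hwm
    rcases (h w hw j hj).eq_or_lt with hpj | hpj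
    · left
      subst hpj
      exact add_right_cancel (hWp.trans hj.symm)
    · right
      have hE : ∀ i, W i + (if p = i then 1 else 0) = w i + (if j = i then 1 else 0) := by
        intro i
        have := DFunLike.congr_fun (hWp.trans hj.symm) i
        simpa [Finsupp.single_apply] using this
      refine ⟨j, fun i hi => ?_, ?_⟩
      · have := hE i
        rwa [if_neg (hpj.trans hi).ne, if_neg hi.ne] at this
      · have := hE j
        rw [if_neg hpj.ne, if_pos rfl] at this
        omega

theorem PP_cons (k : ℕ) (M : Multiset (Mon n)) (w : Mon n) (h1 : M.card + 1 = k)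
    (h2 : ∀ z ∈ M, z ∈ lexSeg n l d a) (hw : w ∈ lexSeg n l d a) : w + M.sum ∈ PP n l d a k := by
  refine ⟨w ::ₘ M, by simpa using h1, ?_, by simp⟩
  intro z hz
  rcases Multiset.mem_cons.1 hz with rfl | hz
  · exact hw
  · exact h2 z hz

theorem exch1 (hd : 2 ≤ d) (hl2 : 2 ≤ l) (hln : l ≤ n - 1) (k : ℕ) (m W : Mon n) (s p : Fin n)
    (hm : m ∈ PP n l d a k) (hp : 1 ≤ m p) (hmin : ∀ i, 1 ≤ m i → p ≤ i) (hps : p < s)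
    (hW : W + Finsupp.single p 1 = m + Finsupp.single s 1) (hlo : k ≤ lo l W) :
    W ∈ PP n l d a k := by
  obtain ⟨M, h1, h2, rfl⟩ := hm
  obtain ⟨w, hw, hwp⟩ := exists_coord M p hp
  obtain ⟨N, rfl⟩ := Multiset.exists_cons_of_mem hw
  obtain ⟨t, rfl⟩ := split w p hwp
  have hN : ∀ z ∈ N, z ∈ lexSeg n l d a := fun z hz => h2 z (by simp [hz])
  have hwL := h2 _ hw
  let o : Fin n := ⟨0, by omega⟩
  have ho : (o : ℕ) = 0 := rfl
  have hps' := Fin.lt_def.1 hps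
  have hso : s ≠ o := by intro h; rw [h] at hps'; omega
  have hWe : W = (t + Finsupp.single s 1) + N.sum := by
    apply add_right_cancel (b := Finsupp.single p 1)
    rw [hW, Multiset.sum_cons]
    abel
  have hto : t o = 0 := by
    by_cases hpo : p = o
    · have := seg_zero hl2 hln _ hwL o ho
      rw [hpo] at this
      simp at this
      omega
    · by_contra hc
      have := hmin o (by rw [Multiset.sum_cons]; simp only [Finsupp.add_apply]; omega)
      apply hpo
      ext
      have := Fin.le_def.1 this
      omega
  have hdt := hwL.1
  rw [deg_add', deg_single'] at hdt
  have hcard : N.card + 1 = k := by simpa using h1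
  by_cases hlo1 : 1 ≤ lo l (t + Finsupp.single s 1)
  · rw [hWe]
    refine PP_cons k N _ hcard hN (seg_of_zero hd hl2 hln _ ?_ hlo1 o ho ?_)
    · rw [deg_add', deg_single', hdt]
    · simp [hto, hso]
  · rw [hWe, lo_add] at hlo
    obtain ⟨z, hz, hz2⟩ := exists_big (l := l) N (by omega)
    obtain ⟨N', rfl⟩ := Multiset.exists_cons_of_mem hz
    have hzL := hN z hz
    obtain ⟨q, hq, hzq⟩ := lo_pos l z (by omega)
    have hzo : z o = 0 := by
      rcases seg_zero hl2 hln _ hzL o ho with h | h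
      · exact h
      · omega
    obtain ⟨y, rfl⟩ := split z q hzq
    have hqo : q ≠ o := by intro h; rw [h] at hzo; simp at hzo
    have hdz := hzL.1
    rw [deg_add', deg_single'] at hdz
    have hyo : y o = 0 := by
      rw [Finsupp.add_apply] at hzo; omega
    rw [lo_add, lo_single, if_pos hq] at hz2
    have hA : t + Finsupp.single q 1 ∈ lexSeg n l d a := by
      refine seg_of_zero hd hl2 hln _ ?_ ?_ o ho ?_
      · rw [deg_add', deg_single', hdt]
      · rw [lo_add, lo_single, if_pos hq]; omega
      · simp [hto, hqo]
    have hB : y + Finsupp.single s 1 ∈ lexSeg n l d a := by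
      refine seg_of_zero hd hl2 hln _ ?_ ?_ o ho ?_
      · rw [deg_add', deg_single', hdz]
      · rw [lo_add]; omega
      · simp [hyo, hso]
    have : W = (t + Finsupp.single q 1) + ((y + Finsupp.single s 1) ::ₘ N').sum := by
      rw [hWe, Multiset.sum_cons, Multiset.sum_cons]
      abel
    rw [this]
    refine PP_cons k _ _ (by simpa using hcard) ?_ hA
    intro x hx
    rcases Multiset.mem_cons.1 hx with rfl | hx
    · exact hB
    · exact hN x (by simp [hx])

theorem exch2 (hd : 2 ≤ d) (hl2 : 2 ≤ l) (hln : l ≤ n - 1) (k : ℕ) (m W : Mon n) (s p : Fin n)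
    (hm : m ∈ PP n l d a k) (hp : 1 ≤ m p) (hpl : l ≤ (p : ℕ)) (hps : p < s)
    (hW : W + Finsupp.single p 1 = m + Finsupp.single s 1) :
    W ∈ PP n l d a k := by
  obtain ⟨M, h1, h2, rfl⟩ := hm
  obtain ⟨w, hw, hwp⟩ := exists_coord M p hp
  obtain ⟨N, rfl⟩ := Multiset.exists_cons_of_mem hw
  obtain ⟨t, rfl⟩ := split w p hwp
  have hwL := h2 _ hw
  have hWe : W = (t + Finsupp.single s 1) + N.sum := by
    apply add_right_cancel (b := Finsupp.single p 1)
    rw [hW, Multiset.sum_cons]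
    abel
  rw [hWe]
  refine PP_cons k N _ (by simpa using h1) (fun z hz => h2 z (by simp [hz])) ?_
  have hdt := hwL.1
  rw [deg_add', deg_single'] at hdt
  have hl := seg_lo hl2 hln _ hwL
  rw [lo_add, lo_single, if_neg (by omega)] at hl
  refine seg_of_lt hd hl2 hln _ _ ?_ ?_ ⟨p, ?_, ?_⟩ hwL
  · rw [deg_add', deg_single', hdt]
  · rw [lo_add]; omega
  · intro j hj
    simp [Finsupp.single_apply, hj.ne', (hj.trans hps).ne']
  · simp [Finsupp.single_apply, hps.ne']

end seg

/-- Description of the decomposition function: for `m ∈ G(I^k)` and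
`s ∈ set(m)`, `g(x_s·m) = x_s·m/x_{min(m)}` if `x_s·m/x_{min(m)} ⪰ v^k`, and
`g(x_s·m) = x_s·m/x_{min(m̃)}` if `x_s·m/x_{min(m)} ≺ v^k`. -/
theorem stmt12 (n d l k : ℕ) (K : Type*) [Field K] (a : ℕ → ℕ)
    (hd : 2 ≤ d) (hl2 : 2 ≤ l) (hln : l ≤ n - 1)
    (hsum : ∑ j ∈ Finset.Ico l n, a j = d - 1) (hk : 1 ≤ k) :
    ∀ m ∈ minGens K ((lexIdeal n l d a K) ^ k),
      ∀ s ∈ setOfGen K ((lexIdeal n l d a K) ^ k) m,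
        (¬ precLT l (m + sing n s - sing n (minIdx m)) (k • vVec n l d) →
          isDecompOf K ((lexIdeal n l d a K) ^ k) (m + sing n s)
            (m + sing n s - sing n (minIdx m))) ∧
        (precLT l (m + sing n s - sing n (minIdx m)) (k • vVec n l d) →
          isDecompOf K ((lexIdeal n l d a K) ^ k) (m + sing n s)
            (m + sing n s - sing n (minIdx (highPart l m)))) := by
  intro m hm s hs
  rw [minGens_eq] at hm
  obtain ⟨hsn, j, z, hz, hjs, hmj, hzj⟩ := set_struct K k m s hm hs
  obtain ⟨p, hpe, hp, hpmin⟩ := minIdx_spec m j hmj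
  have hpj := Fin.le_def.1 (hpmin j hmj)
  have hse := sing_eq (⟨s, hsn⟩ : Fin n)
  simp only at hse
  rw [hpe, sing_eq p, hse]
  obtain ⟨b, hb⟩ := split m p hp
  have hX : m + Finsupp.single ⟨s, hsn⟩ 1 - Finsupp.single p 1 = b + Finsupp.single ⟨s, hsn⟩ 1 := by
    rw [hb, add_right_comm, add_tsub_cancel_right]
  have hXe : b + Finsupp.single ⟨s, hsn⟩ 1 + Finsupp.single p 1 = m + Finsupp.single ⟨s, hsn⟩ 1 := by
    rw [hb]; abel
  rw [hX]
  have hps : p < ⟨s, hsn⟩ := by rw [Fin.lt_def]; simp only; omega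
  have hsupp : ∀ (w : Mon n) (i : Fin n),
      w + Finsupp.single i 1 = m + Finsupp.single ⟨s, hsn⟩ 1 → 1 ≤ m i ∨ i = ⟨s, hsn⟩ := by
    intro w i h
    by_cases hi : i = ⟨s, hsn⟩
    · exact Or.inr hi
    · left
      have := DFunLike.congr_fun h i
      rw [Finsupp.add_apply, Finsupp.add_apply, Finsupp.single_apply, Finsupp.single_apply,
        if_pos rfl, if_neg (Ne.symm hi)] at this
      omega
  have hlov : lo l (k • vVec n l d) = k := by
    have h1 : ∀ i : Fin n, (i : ℕ) < l → i ≠ ⟨l - 1, by omega⟩ → (k • vVec n l d) i = 0 := by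
      intro i hi hne
      have : (i : ℕ) ≠ l - 1 := fun h => hne (Fin.ext h)
      rw [Finsupp.smul_apply, v_apply, if_neg this, if_neg (by omega)]; simp
    rw [lo_only l _ ⟨l - 1, by omega⟩ (by simp only; omega) h1, Finsupp.smul_apply, v_apply,
      if_pos rfl, if_neg (by simp only; omega)]
    simp
  have hdX : deg (b + Finsupp.single ⟨s, hsn⟩ 1) = k * d := by
    have := deg_PP k m hm
    rw [hb, deg_add', deg_single'] at this
    rw [deg_add', deg_single', this]
  constructor
  · intro h
    have hk' : k ≤ lo l (b + Finsupp.single ⟨s, hsn⟩ 1) := by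
      by_contra hc
      apply h
      left
      change lo l _ < lo l _
      omega
    refine decomp_of K k m _ _ p hm (exch1 hd hl2 hln k m _ _ p hm hp hpmin hps hXe hk') hXe ?_
    intro w _ i hi
    rcases hsupp w i hi with h | h
    · exact hpmin i h
    · rw [h]; exact hps.le
  · intro h
    have hk' : lo l (b + Finsupp.single ⟨s, hsn⟩ 1) < k := by
      rcases h with h | ⟨h, h'⟩
      · change lo l _ < lo l _ at h
        omega
      · change lo l _ = lo l _ at h
        exact absurd h' (not_lex_v hd hl2 hln _ hdX (by omega))
    have hloP : ∀ w ∈ PP n l d a k, k ≤ lo l w := by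
      rintro w ⟨M, rfl, h2, rfl⟩
      exact lo_PP hl2 hln M h2
    have hhigh : ∀ w ∈ PP n l d a k, ∀ i : Fin n,
        w + Finsupp.single i 1 = m + Finsupp.single ⟨s, hsn⟩ 1 → l ≤ (i : ℕ) := by
      intro w hw i hi
      by_contra hc
      have h1 := congrArg (lo l) (hi.trans hXe.symm)
      rw [lo_add, lo_add _ (b + _), lo_single, lo_single, if_pos (by omega)] at h1
      have := hloP w hw
      split_ifs at h1 <;> omega
    have hjl := hhigh z hz j hzj
    have hHP : ∀ i : Fin n, highPart l m i = if l ≤ (i : ℕ) then m i else 0 := by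
      intro i; simp [highPart, Finsupp.filter_apply]
    obtain ⟨q, hqe, hq, hqmin⟩ := minIdx_spec (highPart l m) j (by rw [hHP, if_pos hjl]; exact hmj)
    have hql : l ≤ (q : ℕ) := by
      by_contra hc
      rw [hHP, if_neg hc] at hq
      omega
    rw [hHP, if_pos hql] at hq
    have hqj := Fin.le_def.1 (hqmin j (by rw [hHP, if_pos hjl]; exact hmj))
    have hqs : q < ⟨s, hsn⟩ := by rw [Fin.lt_def]; simp only; omega
    rw [hqe, sing_eq q]
    obtain ⟨c, hc⟩ := split m q hq
    have hY : m + Finsupp.single ⟨s, hsn⟩ 1 - Finsupp.single q 1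
        = c + Finsupp.single ⟨s, hsn⟩ 1 := by
      rw [hc, add_right_comm, add_tsub_cancel_right]
    have hYe : c + Finsupp.single ⟨s, hsn⟩ 1 + Finsupp.single q 1
        = m + Finsupp.single ⟨s, hsn⟩ 1 := by
      rw [hc]; abel
    rw [hY]
    refine decomp_of K k m _ _ q hm (exch2 hd hl2 hln k m _ _ q hm hq hql hqs hYe) hYe ?_
    intro w hw i hi
    have hil := hhigh w hw i hi
    rcases hsupp w i hi with h | h
    · exact hqmin i (by rw [hHP, if_pos hil]; exact h)
    · rw [h]; exact hqs.le
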